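/- arXiv:1505.07788 — 2 statements merged into one kernel-verified Lean document; each statement's English description precedes it below -/
import Mathlib

section
/- Let {d_{n+1}}_{n=1}^{∞} be a positive chain sequence, let W_n be defined by W_0(x) = 1, W_1(x) = x and W_{n+1}(x) = x W_n(x) − d_{n+1} W_{n−1}(x) for n ≥ 1, and let x_{n,1} denote the largest real zero of W_n. Then the limit ξ = lim_{n→∞} x_{n,1} exists, and for q with 0 < q ≤ 1 the constant sequence {q}_{n=1}^{∞} is a scaling sequence for {d_{n+1}}_{n=1}^{∞} (i.e., {d_{n+1}/q}_{n=1}^{∞} is a positive chain sequence) if and only if q ≥ ξ². -/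
noncomputable section

/-- The functions `W n`, where `W c d n x` is `W_n(x)`: `W_0 = 1`, `W_1(x) = x - c_1*sqrt(1-x^2)`,
`W_{n+1}(x) = (x - c_{n+1}*sqrt(1-x^2)) W_n(x) - d_{n+1} W_{n-1}(x)`. -/
def W (c d : ℕ → ℝ) : ℕ → ℝ → ℝ
  | 0, _ => 1
  | 1, x => x - c 1 * Real.sqrt (1 - x ^ 2)
  | n + 2, x =>
      (x - c (n + 2) * Real.sqrt (1 - x ^ 2)) * W c d (n + 1) x - d (n + 2) * W c d n x

/-- `{d_{n+1}}_{n≥1}` is a positive chain sequence: there is a parameter sequence `g` with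
`0 ≤ g_1 < 1`, `0 < g_n < 1` for `n ≥ 2`, and `d_{n+1} = (1 - g_n) g_{n+1}` for `n ≥ 1`. -/
def IsPositiveChainSeq (d : ℕ → ℝ) : Prop :=
  ∃ g : ℕ → ℝ, (0 ≤ g 1 ∧ g 1 < 1) ∧ (∀ n, 2 ≤ n → 0 < g n ∧ g n < 1) ∧
    ∀ n, 1 ≤ n → d (n + 1) = (1 - g n) * g (n + 1)

/-- `{q_{n+1}}_{n≥1}` is a scaling sequence for `{d_{n+1}}_{n≥1}`: it is positive,
`q_{n+1} ≤ 1`, and `{d_{n+1}/q_{n+1}}_{n≥1}` is a positive chain sequence. -/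
def IsScalingSeq (d q : ℕ → ℝ) : Prop :=
  (∀ n, 1 ≤ n → 0 < q (n + 1) ∧ q (n + 1) ≤ 1) ∧
  IsPositiveChainSeq (fun k => d k / q k)

theorem W_zero_succ_succ (d : ℕ → ℝ) (n : ℕ) (x : ℝ) :
    W (fun _ => 0) d (n + 2) x =
      x * W (fun _ => 0) d (n + 1) x - d (n + 2) * W (fun _ => 0) d n x := by
  simp [W]

theorem W_zero_one (d : ℕ → ℝ) (x : ℝ) : W (fun _ => 0) d 1 x = x := by
  simp [W]

theorem W_zero_zero (d : ℕ → ℝ) (x : ℝ) : W (fun _ => 0) d 0 x = 1 := by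
  simp [W]

theorem continuous_W_zero (d : ℕ → ℝ) (n : ℕ) : Continuous (W (fun _ => 0) d n) := by
  have h : Continuous (W (fun _ => 0) d n) ∧ Continuous (W (fun _ => 0) d (n + 1)) := by
    induction n with
    | zero =>
      refine ⟨?_, ?_⟩
      · rw [funext (W_zero_zero d)]; fun_prop
      · rw [funext (W_zero_one d)]; fun_prop
    | succ k ih =>
      refine ⟨ih.2, ?_⟩
      have h1 := ih.1
      have h2 := ih.2
      rw [funext (W_zero_succ_succ d k)]
      fun_prop
  exact h.1

theorem IsPositiveChainSeq.pos {d : ℕ → ℝ} (hd : IsPositiveChainSeq d) (n : ℕ) :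
    0 < d (n + 2) := by
  obtain ⟨g, h1, h2, h3⟩ := hd
  rw [h3 (n + 1) (by omega)]
  have hg : g (n + 1) < 1 := by
    rcases n with _ | n
    · exact h1.2
    · exact (h2 (n + 2) (by omega)).2
  exact mul_pos (by linarith) (h2 (n + 1 + 1) (by omega)).1

/-- If `{d_{n+1}/s^2}` is a positive chain sequence, then every `W_n` is positive on `[s, ∞)`. -/
theorem W_zero_pos_of_chain {d : ℕ → ℝ} {s x : ℝ} (hs : 0 < s) (hx : s ≤ x)
    (hd : IsPositiveChainSeq (fun k => d k / s ^ 2)) (n : ℕ) :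
    0 < W (fun _ => 0) d n x := by
  obtain ⟨g, h1, h2, h3⟩ := hd
  have hlt : ∀ n, g (n + 1) < 1 := by
    rintro (_ | n)
    · exact h1.2
    · exact (h2 (n + 2) (by omega)).2
  have key : 0 < W (fun _ => 0) d n x ∧
      s * (1 - g (n + 1)) * W (fun _ => 0) d n x ≤ W (fun _ => 0) d (n + 1) x := by
    induction n with
    | zero =>
      rw [W_zero_zero, W_zero_one]
      exact ⟨one_pos, by nlinarith [h1.1]⟩
    | succ k ih =>
      obtain ⟨hp, hle⟩ := ih
      have hp' : 0 < W (fun _ => 0) d (k + 1) x :=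
        lt_of_lt_of_le (mul_pos (mul_pos hs (by linarith [hlt k])) hp) hle
      refine ⟨hp', ?_⟩
      have hdk : d (k + 2) = s ^ 2 * ((1 - g (k + 1)) * g (k + 2)) := by
        have := h3 (k + 1) (by omega)
        rw [← this]
        field_simp
      have hg := (h2 (k + 2) (by omega)).1
      rw [W_zero_succ_succ, hdk]
      have e1 := mul_le_mul_of_nonneg_left hle (mul_pos hs hg).le
      have e2 := mul_le_mul_of_nonneg_right hx hp'.le
      linarith
  exact key.1

/-- If every `W_n` is positive at `s`, then the ratios `W_n(s)/(s W_{n-1}(s))` provide parameters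
showing that `{d_{n+1}/s^2}` is a positive chain sequence. -/
theorem isPositiveChainSeq_of_W_zero_pos {d : ℕ → ℝ} {s : ℝ} (hs : 0 < s)
    (hd : ∀ n, 0 < d (n + 2)) (hW : ∀ n, 0 < W (fun _ => 0) d n s) :
    IsPositiveChainSeq (fun k => d k / s ^ 2) := by
  have hg : ∀ n, 1 - W (fun _ => 0) d (n + 2) s / (s * W (fun _ => 0) d (n + 1) s) =
      d (n + 2) * W (fun _ => 0) d n s / (s * W (fun _ => 0) d (n + 1) s) := by
    intro n
    have h1 := (hW (n + 1)).ne'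
    rw [W_zero_succ_succ]
    field_simp
    ring
  refine ⟨fun n => 1 - W (fun _ => 0) d n s / (s * W (fun _ => 0) d (n - 1) s), ?_, ?_, ?_⟩
  · simp [W_zero_zero, W_zero_one, hs.ne']
  · intro n hn
    obtain ⟨m, rfl⟩ := Nat.exists_eq_add_of_le' hn
    have hpos := div_pos (hW (m + 2)) (mul_pos hs (hW (m + 1)))
    refine ⟨?_, ?_⟩
    · change 0 < 1 - W (fun _ => 0) d (m + 2) s / (s * W (fun _ => 0) d (m + 1) s)
      rw [hg]
      exact div_pos (mul_pos (hd m) (hW m)) (mul_pos hs (hW (m + 1)))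
    · change 1 - W (fun _ => 0) d (m + 2) s / (s * W (fun _ => 0) d (m + 1) s) < 1
      linarith
  · intro n hn
    obtain ⟨m, rfl⟩ := Nat.exists_eq_add_of_le' hn
    change d (m + 2) / s ^ 2 =
      (1 - (1 - W (fun _ => 0) d (m + 1) s / (s * W (fun _ => 0) d m s))) *
        (1 - W (fun _ => 0) d (m + 2) s / (s * W (fun _ => 0) d (m + 1) s))
    rw [hg]
    have h0 := (hW m).ne'
    have h1 := (hW (m + 1)).ne'
    field_simp
    ring

/-- A continuous function that is positive at `b` and has no zeros beyond `r < b` is positive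
on `(r, ∞)`. -/
theorem pos_of_root_le {f : ℝ → ℝ} (hf : Continuous f) {r b x : ℝ}
    (hr : ∀ y, f y = 0 → y ≤ r) (hb : r < b) (hfb : 0 < f b) (hx : r < x) : 0 < f x := by
  by_contra! h
  obtain ⟨y, hy, hy0⟩ := isPreconnected_Ioi.intermediate_value (s := Set.Ioi r)
    (Set.mem_Ioi.2 hx) (Set.mem_Ioi.2 hb) hf.continuousOn (show (0 : ℝ) ∈ Set.Icc (f x) (f b) from
      ⟨h, hfb.le⟩)
  exact (hr y hy0).not_gt hy

theorem stmt10 (d : ℕ → ℝ) (hd : IsPositiveChainSeq d)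
    (x1 : ℕ → ℝ)
    (hroot : ∀ n, 1 ≤ n → W (fun _ => 0) d n (x1 n) = 0)
    (hmax : ∀ n, 1 ≤ n → ∀ y : ℝ, W (fun _ => 0) d n y = 0 → y ≤ x1 n) :
    ∃ ξ : ℝ, Filter.Tendsto x1 Filter.atTop (nhds ξ) ∧
      ∀ q : ℝ, 0 < q → q ≤ 1 →
        (IsScalingSeq d (fun _ => q) ↔ ξ ^ 2 ≤ q) := by
  have hdpos := hd.pos
  have hroot_lt : ∀ s, 0 < s → IsPositiveChainSeq (fun k => d k / s ^ 2) →
      ∀ n, x1 (n + 1) < s := by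
    intro s hs hc n
    by_contra! h
    exact (W_zero_pos_of_chain hs h hc (n + 1)).ne' (hroot (n + 1) (by omega))
  have hd1 : IsPositiveChainSeq (fun k => d k / (1 : ℝ) ^ 2) := by simpa using hd
  have hlt1 := hroot_lt 1 one_pos hd1
  have hpos : ∀ n x, x1 (n + 1) < x → 0 < W (fun _ => 0) d (n + 1) x := fun n x hx =>
    pos_of_root_le (continuous_W_zero d _) (hmax (n + 1) (by omega)) (hlt1 n)
      (W_zero_pos_of_chain one_pos le_rfl hd1 _) hx
  have hstep : ∀ n, 0 < W (fun _ => 0) d n (x1 (n + 1)) → x1 (n + 1) < x1 (n + 2) := by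
    intro n hn
    by_contra! h
    have hneg : W (fun _ => 0) d (n + 2) (x1 (n + 1)) < 0 := by
      rw [W_zero_succ_succ, hroot (n + 1) (by omega)]
      have := mul_pos (hdpos n) hn
      linarith
    rcases h.lt_or_eq with h | h
    · exact (hpos (n + 1) _ h).not_gt hneg
    · rw [← h, hroot (n + 2) (by omega)] at hneg
      exact lt_irrefl _ hneg
  have hmono' : ∀ n, x1 (n + 1) < x1 (n + 2) := by
    intro n
    induction n with
    | zero => exact hstep 0 (by rw [W_zero_zero]; exact one_pos)
    | succ k ih => exact hstep (k + 1) (hpos k _ ih)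
  have hmono : StrictMono (fun n => x1 (n + 1)) := strictMono_nat_of_lt_succ hmono'
  have hbdd : BddAbove (Set.range (fun n => x1 (n + 1))) :=
    ⟨1, by rintro _ ⟨n, rfl⟩; exact (hlt1 n).le⟩
  have hlim := tendsto_atTop_ciSup hmono.monotone hbdd
  set ξ : ℝ := ⨆ n, x1 (n + 1) with hξ
  have hltξ : ∀ n, x1 (n + 1) < ξ := fun n => (hmono' n).trans_le (le_ciSup hbdd (n + 1))
  have hx11 : x1 1 = 0 := by
    have := hroot 1 le_rfl
    rwa [W_zero_one] at this
  have hξ0 : 0 < ξ := hx11 ▸ hltξ 0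
  refine ⟨ξ, (Filter.tendsto_add_atTop_iff_nat 1).1 hlim, fun q hq hq1 => ?_⟩
  have hs : 0 < Real.sqrt q := Real.sqrt_pos.2 hq
  have hsq : Real.sqrt q ^ 2 = q := Real.sq_sqrt hq.le
  constructor
  · rintro ⟨-, hc⟩
    have hle : ξ ≤ Real.sqrt q :=
      ciSup_le fun n => (hroot_lt _ hs (by rw [hsq]; exact hc) n).le
    rw [← hsq]
    exact pow_le_pow_left₀ hξ0.le hle 2
  · intro hle
    refine ⟨fun _ _ => ⟨hq, hq1⟩, ?_⟩
    have hξs : ξ ≤ Real.sqrt q := Real.le_sqrt_of_sq_le hle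
    have := isPositiveChainSeq_of_W_zero_pos hs hdpos (fun n => by
      rcases n with _ | n
      · rw [W_zero_zero]; exact one_pos
      · exact hpos n _ ((hltξ n).trans_le hξs))
    rwa [hsq] at this
end
end

section
/- Let {c_n}_{n≥1} be real, let {d_{n+1}}_{n≥1} be a positive chain sequence, and let W_n be defined by the recurrence. Let −1 < β₂ < β₁ < 1 and let ψ be a positive Borel measure on [−1,1] whose support is an infinite set and satisfies supp(ψ) ∩ (β₂, β₁) = ∅. Assume that for every n ≥ 1 and every F ∈ Ω_{n−1} one has ∫_{−1}^{1} F(x) W_n(x) dψ(x) = 0. Then for every n ≥ 1 the function W_n has at most one zero in the closed interval [β₂, β₁]. -/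
noncomputable section

/-- Membership in the class `Ω_n`: for `n ≥ 1`, `F : [-1,1] → ℝ` has the form
`F(x) = p(x) + √(1-x²) r(x)` with `deg p ≤ n`, `p(-x) = (-1)ⁿ p(x)`, `deg r ≤ n-1`,
`r(-x) = (-1)^{n-1} r(x)`; `Ω_0` consists of the constant functions. -/
def MemOmega : ℕ → (ℝ → ℝ) → Prop
  | 0, F => ∃ a : ℝ, ∀ x ∈ Set.Icc (-1 : ℝ) 1, F x = a
  | n + 1, F => ∃ p r : Polynomial ℝ, p.natDegree ≤ n + 1 ∧ r.natDegree ≤ n ∧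
      (∀ x : ℝ, p.eval (-x) = (-1 : ℝ) ^ (n + 1) * p.eval x) ∧
      (∀ x : ℝ, r.eval (-x) = (-1 : ℝ) ^ n * r.eval x) ∧
      ∀ x ∈ Set.Icc (-1 : ℝ) 1, F x = p.eval x + Real.sqrt (1 - x ^ 2) * r.eval x

/-- The support of a Borel measure on `ℝ`: points all of whose neighborhoods have
positive measure. -/
def msupport (ψ : MeasureTheory.Measure ℝ) : Set ℝ := {x | ∀ U ∈ nhds x, 0 < ψ U}

open Polynomial in
/-- The polynomials `w n` with `W n x = (√(1 - x²)) ^ n * w n (x / √(1 - x²))` on `(-1, 1)`. -/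
def cotPoly (c d : ℕ → ℝ) : ℕ → Polynomial ℝ
  | 0 => 1
  | 1 => X - C (c 1)
  | n + 2 => (X - C (c (n + 2))) * cotPoly c d (n + 1) - C (d (n + 2)) * (1 + X ^ 2) * cotPoly c d n

theorem natDegree_cotPoly_le (c d : ℕ → ℝ) : ∀ n, (cotPoly c d n).natDegree ≤ n
  | 0 => by simp [cotPoly]
  | 1 => by simp [cotPoly]
  | n + 2 => by
    have h₁ := natDegree_cotPoly_le c d (n + 1)
    have h₀ := natDegree_cotPoly_le c d n
    rw [cotPoly]
    refine (Polynomial.natDegree_sub_le _ _).trans (max_le ?_ ?_)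
    · refine Polynomial.natDegree_mul_le.trans ?_
      rw [Polynomial.natDegree_X_sub_C]
      omega
    · refine Polynomial.natDegree_mul_le.trans ?_
      have : (Polynomial.C (d (n + 2)) * (1 + Polynomial.X ^ 2) : Polynomial ℝ).natDegree ≤ 2 := by
        compute_degree
      omega

theorem aeval_I_cotPoly_ne_zero (c d : ℕ → ℝ) :
    ∀ n, Polynomial.aeval Complex.I (cotPoly c d n) ≠ 0
  | 0 => by simp [cotPoly]
  | 1 => by
    intro h
    have := congrArg Complex.im h
    simp [cotPoly] at this
  | n + 2 => by
    have h₁ := aeval_I_cotPoly_ne_zero c d (n + 1)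
    simp only [cotPoly, map_sub, map_mul, map_add, map_pow, map_one, Polynomial.aeval_X,
      Polynomial.aeval_C, Complex.I_sq, add_neg_cancel, mul_zero, zero_mul, sub_zero]
    refine mul_ne_zero (fun h => ?_) h₁
    have := congrArg Complex.im h
    simp at this

theorem cotPoly_ne_zero (c d : ℕ → ℝ) (n : ℕ) : cotPoly c d n ≠ 0 := fun h =>
  aeval_I_cotPoly_ne_zero c d n (by rw [h, map_zero])

theorem sqrt_one_sub_sq_pos {x : ℝ} (hx : x ∈ Set.Ioo (-1 : ℝ) 1) : 0 < √(1 - x ^ 2) :=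
  Real.sqrt_pos.mpr (by nlinarith [hx.1, hx.2])

theorem W_eq_pow_mul_eval_cotPoly (c d : ℕ → ℝ) {x : ℝ} (hx : x ∈ Set.Ioo (-1 : ℝ) 1) :
    ∀ n, W c d n x = √(1 - x ^ 2) ^ n * (cotPoly c d n).eval (x / √(1 - x ^ 2))
  | 0 => by simp [W, cotPoly]
  | 1 => by
    have hs := (sqrt_one_sub_sq_pos hx).ne'
    simp only [W, cotPoly, Polynomial.eval_sub, Polynomial.eval_X, Polynomial.eval_C]
    field_simp
  | n + 2 => by
    have hs := (sqrt_one_sub_sq_pos hx).ne'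
    have hsq : √(1 - x ^ 2) ^ 2 = 1 - x ^ 2 :=
      Real.sq_sqrt (by nlinarith [hx.1, hx.2])
    rw [W, W_eq_pow_mul_eval_cotPoly c d hx (n + 1), W_eq_pow_mul_eval_cotPoly c d hx n]
    simp only [cotPoly, Polynomial.eval_sub, Polynomial.eval_X, Polynomial.eval_C,
      Polynomial.eval_mul, Polynomial.eval_add, Polynomial.eval_one, Polynomial.eval_pow]
    generalize Polynomial.eval (x / √(1 - x ^ 2)) (cotPoly c d (n + 1)) = A
    generalize Polynomial.eval (x / √(1 - x ^ 2)) (cotPoly c d n) = B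
    generalize √(1 - x ^ 2) = s at *
    have h1 : s ^ 2 * (1 + (x / s) ^ 2) = 1 := by
      field_simp
      linarith
    have h2 : s * (x / s) = x := by field_simp
    linear_combination (- (A * s ^ (n + 1))) * h2 + d (n + 2) * s ^ n * B * h1

theorem continuous_W (c d : ℕ → ℝ) : ∀ n, Continuous (W c d n)
  | 0 => by
    have : W c d 0 = fun _ => 1 := funext fun x => by rw [W]
    rw [this]
    fun_prop
  | 1 => by
    have : W c d 1 = fun x => x - c 1 * √(1 - x ^ 2) := funext fun x => by rw [W]
    rw [this]
    fun_prop
  | n + 2 => by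
    have h₁ := continuous_W c d (n + 1)
    have h₀ := continuous_W c d n
    have : W c d (n + 2) = fun x =>
        (x - c (n + 2) * √(1 - x ^ 2)) * W c d (n + 1) x - d (n + 2) * W c d n x :=
      funext fun x => by rw [W]
    rw [this]
    fun_prop

theorem strictMonoOn_div_sqrt_one_sub_sq :
    StrictMonoOn (fun x : ℝ => x / √(1 - x ^ 2)) (Set.Ioo (-1) 1) := by
  intro x hx y hy hxy
  simp only [← Real.tan_arcsin]
  have hmem : ∀ z ∈ Set.Ioo (-1 : ℝ) 1, Real.arcsin z ∈ Set.Ioo (-(Real.pi / 2)) (Real.pi / 2) :=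
    fun z hz => ⟨Real.neg_pi_div_two_lt_arcsin.mpr hz.1, Real.arcsin_lt_pi_div_two.mpr hz.2⟩
  exact Real.strictMonoOn_tan (hmem x hx) (hmem y hy)
    (Real.strictMonoOn_arcsin (Set.Ioo_subset_Icc_self hx) (Set.Ioo_subset_Icc_self hy) hxy)

theorem memOmega_zero_fun (n : ℕ) : MemOmega (n + 1) (fun _ => 0) :=
  ⟨0, 0, by simp, by simp, by simp, by simp, by simp⟩

theorem MemOmega.add {n : ℕ} {F G : ℝ → ℝ} (hF : MemOmega (n + 1) F) (hG : MemOmega (n + 1) G) :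
    MemOmega (n + 1) (fun x => F x + G x) := by
  obtain ⟨p, r, hp, hr, hp', hr', h⟩ := hF
  obtain ⟨p₂, r₂, hp₂, hr₂, hp₂', hr₂', h₂⟩ := hG
  refine ⟨p + p₂, r + r₂, Polynomial.natDegree_add_le_of_degree_le hp hp₂,
    Polynomial.natDegree_add_le_of_degree_le hr hr₂, fun x => ?_, fun x => ?_, fun x hx => ?_⟩
  · rw [Polynomial.eval_add, Polynomial.eval_add, hp', hp₂', mul_add]
  · rw [Polynomial.eval_add, Polynomial.eval_add, hr', hr₂', mul_add]
  · simp only [h x hx, h₂ x hx, Polynomial.eval_add]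
    ring

theorem MemOmega.const_mul {n : ℕ} {F : ℝ → ℝ} (a : ℝ) (hF : MemOmega (n + 1) F) :
    MemOmega (n + 1) (fun x => a * F x) := by
  obtain ⟨p, r, hp, hr, hp', hr', h⟩ := hF
  refine ⟨Polynomial.C a * p, Polynomial.C a * r, (Polynomial.natDegree_C_mul_le _ _).trans hp,
    (Polynomial.natDegree_C_mul_le _ _).trans hr, fun x => ?_, fun x => ?_, fun x hx => ?_⟩
  · rw [Polynomial.eval_C_mul, Polynomial.eval_C_mul, hp']
    ring
  · rw [Polynomial.eval_C_mul, Polynomial.eval_C_mul, hr']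
    ring
  · simp only [h x hx, Polynomial.eval_C_mul]
    ring

theorem MemOmega.sum {n : ℕ} {ι : Type*} (s : Finset ι) {F : ι → ℝ → ℝ}
    (hF : ∀ i ∈ s, MemOmega (n + 1) (F i)) : MemOmega (n + 1) (fun x => ∑ i ∈ s, F i x) := by
  classical
  induction s using Finset.induction_on with
  | empty => simpa using memOmega_zero_fun n
  | insert a s ha ih =>
    simp only [Finset.sum_insert ha]
    exact (hF a (Finset.mem_insert_self a s)).add
      (ih fun i hi => hF i (Finset.mem_insert_of_mem hi))

theorem natDegree_X_pow_mul_one_sub_sq_pow_le (k i : ℕ) :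
    (Polynomial.X ^ k * (1 - Polynomial.X ^ 2) ^ i : Polynomial ℝ).natDegree ≤ k + 2 * i := by
  refine Polynomial.natDegree_mul_le_of_le (by compute_degree) ?_
  rw [mul_comm]
  exact Polynomial.natDegree_pow_le_of_le i (by compute_degree)

theorem eval_neg_X_pow_mul_one_sub_sq_pow (k i : ℕ) (x : ℝ) :
    (Polynomial.X ^ k * (1 - Polynomial.X ^ 2) ^ i : Polynomial ℝ).eval (-x) =
      (-1 : ℝ) ^ (k + 2 * i) * (Polynomial.X ^ k * (1 - Polynomial.X ^ 2) ^ i : Polynomial ℝ).eval x := by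
  simp [pow_add, pow_mul, neg_pow x k, mul_assoc]

theorem memOmega_pow_mul_sqrt_pow {n k j : ℕ} (h : k + j = n + 1) :
    MemOmega (n + 1) (fun x => x ^ k * √(1 - x ^ 2) ^ j) := by
  have hsq : ∀ x ∈ Set.Icc (-1 : ℝ) 1, √(1 - x ^ 2) ^ 2 = 1 - x ^ 2 :=
    fun x hx => Real.sq_sqrt (by nlinarith [hx.1, hx.2])
  obtain ⟨i, rfl | rfl⟩ := j.even_or_odd'
  · refine ⟨Polynomial.X ^ k * (1 - Polynomial.X ^ 2) ^ i, 0, ?_, by simp, fun x => ?_, by simp,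
      fun x hx => ?_⟩
    · exact h ▸ natDegree_X_pow_mul_one_sub_sq_pow_le k i
    · rw [eval_neg_X_pow_mul_one_sub_sq_pow, h]
    · simp [pow_mul, hsq x hx]
  · obtain rfl : n = k + 2 * i := by omega
    refine ⟨0, Polynomial.X ^ k * (1 - Polynomial.X ^ 2) ^ i, by simp,
      natDegree_X_pow_mul_one_sub_sq_pow_le k i, by simp, eval_neg_X_pow_mul_one_sub_sq_pow k i,
      fun x hx => ?_⟩
    simp only [pow_succ √(1 - x ^ 2) (2 * i), pow_mul, hsq x hx, Polynomial.eval_zero, zero_add,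
      Polynomial.eval_mul, Polynomial.eval_pow, Polynomial.eval_X, Polynomial.eval_sub,
      Polynomial.eval_one]
    ring

/-- For `g` of degree at most `m`, the function `√(1 - x²) ^ (m + 1) * g (x / √(1 - x²))` extends
to a continuous element of `Ω (m + 1)` that vanishes at `±1`. -/
theorem exists_memOmega_eq_pow_mul_eval {m : ℕ} {g : Polynomial ℝ} (hg : g.natDegree ≤ m) :
    ∃ F : ℝ → ℝ, MemOmega (m + 1) F ∧ Continuous F ∧ (∀ x, √(1 - x ^ 2) = 0 → F x = 0) ∧
      ∀ x ∈ Set.Ioo (-1 : ℝ) 1, F x = √(1 - x ^ 2) ^ (m + 1) * g.eval (x / √(1 - x ^ 2)) := by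
  refine ⟨fun x => ∑ k ∈ Finset.range (m + 1),
    g.coeff k * (x ^ k * √(1 - x ^ 2) ^ (m + 1 - k)), ?_, by fun_prop, fun x hx => ?_,
    fun x hx => ?_⟩
  · refine MemOmega.sum _ fun k hk => (memOmega_pow_mul_sqrt_pow ?_).const_mul _
    have := Finset.mem_range.mp hk
    omega
  · refine Finset.sum_eq_zero fun k hk => ?_
    have := Finset.mem_range.mp hk
    rw [hx, zero_pow (by omega), mul_zero, mul_zero]
  · have hs := (sqrt_one_sub_sq_pos hx).ne'
    rw [Polynomial.eval_eq_sum_range' (Nat.lt_succ_of_le hg), Finset.mul_sum]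
    refine Finset.sum_congr rfl fun k hk => ?_
    have hk' := Finset.mem_range.mp hk
    rw [show √(1 - x ^ 2) ^ (m + 1) = √(1 - x ^ 2) ^ k * √(1 - x ^ 2) ^ (m + 1 - k) by
      rw [← pow_add]; congr 1; omega, div_pow]
    field_simp

open MeasureTheory in
theorem measure_eq_zero_of_disjoint_msupport {ψ : Measure ℝ} {s : Set ℝ}
    (h : msupport ψ ∩ s = ∅) : ψ s = 0 := by
  refine measure_null_of_locally_null s fun x hx => ?_
  have hx' : x ∉ msupport ψ := fun hm => (h ▸ ⟨hm, hx⟩ : x ∈ (∅ : Set ℝ))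
  simp only [msupport, Set.mem_ofPred_eq, not_forall, not_lt, nonpos_iff_eq_zero] at hx'
  obtain ⟨U, hU, hU0⟩ := hx'
  exact ⟨U, mem_nhdsWithin_of_mem_nhds hU, hU0⟩

open MeasureTheory in
theorem msupport_subset_of_isClosed {ψ : Measure ℝ} {Z : Set ℝ} (hZ : IsClosed Z)
    (h : ψ Zᶜ = 0) : msupport ψ ⊆ Z := fun x hx => by
  by_contra hxZ
  exact (hx Zᶜ (hZ.isOpen_compl.mem_nhds hxZ)).ne' h

theorem finite_setOf_eval_div_sqrt_eq_zero {P : Polynomial ℝ} (hP : P ≠ 0) :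
    {x ∈ Set.Ioo (-1 : ℝ) 1 | P.eval (x / √(1 - x ^ 2)) = 0}.Finite := by
  refine Set.Finite.of_finite_image (f := fun x : ℝ => x / √(1 - x ^ 2))
    ((Polynomial.finite_setOfPred_isRoot hP).subset ?_)
    (strictMonoOn_div_sqrt_one_sub_sq.injOn.mono fun x hx => hx.1)
  rintro _ ⟨x, hx, rfl⟩
  exact hx.2

open MeasureTheory in
theorem stmt15 (c d : ℕ → ℝ) (hd : IsPositiveChainSeq d)
    (β₂ β₁ : ℝ) (hβ₂ : -1 < β₂) (hββ : β₂ < β₁) (hβ₁ : β₁ < 1)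
    (ψ : Measure ℝ) [IsFiniteMeasure ψ]
    (hnull : ψ (Set.Icc (-1 : ℝ) 1)ᶜ = 0)
    (hsupp : msupport ψ ⊆ Set.Icc (-1) 1)
    (hgap : msupport ψ ∩ Set.Ioo β₂ β₁ = ∅)
    (hinf : (msupport ψ).Infinite)
    (horth : ∀ n, 1 ≤ n → ∀ F : ℝ → ℝ, MemOmega (n - 1) F →
      ∫ x in Set.Icc (-1 : ℝ) 1, F x * W c d n x ∂ψ = 0) :
    ∀ n, 1 ≤ n → ∀ x ∈ Set.Icc β₂ β₁, ∀ y ∈ Set.Icc β₂ β₁,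
      W c d n x = 0 → W c d n y = 0 → x = y := by
  intro n _ x hx y hy hWx hWy
  by_contra hxy
  have hsub : ∀ z ∈ Set.Icc β₂ β₁, z ∈ Set.Ioo (-1 : ℝ) 1 :=
    fun z hz => ⟨hβ₂.trans_le hz.1, hz.2.trans_lt hβ₁⟩
  set τ : ℝ → ℝ := fun x => x / √(1 - x ^ 2) with hτ
  have hmono : StrictMonoOn τ (Set.Ioo (-1) 1) := strictMonoOn_div_sqrt_one_sub_sq
  have hroot : ∀ z ∈ Set.Icc β₂ β₁, W c d n z = 0 → (cotPoly c d n).IsRoot (τ z) := by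
    intro z hz hW
    rw [W_eq_pow_mul_eval_cotPoly c d (hsub z hz)] at hW
    exact (mul_eq_zero.mp hW).resolve_left (pow_ne_zero _ (sqrt_one_sub_sq_pos (hsub z hz)).ne')
  have hτxy : τ x ≠ τ y := fun h => hxy (hmono.injOn (hsub x hx) (hsub y hy) h)
  obtain ⟨g, hg⟩ : ∃ g, cotPoly c d n =
      (Polynomial.X - Polynomial.C (τ x)) * (Polynomial.X - Polynomial.C (τ y)) * g :=
    IsCoprime.mul_dvd (Polynomial.isCoprime_X_sub_C_of_isUnit_sub (sub_ne_zero.mpr hτxy).isUnit)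
      (Polynomial.dvd_iff_isRoot.mpr (hroot x hx hWx))
      (Polynomial.dvd_iff_isRoot.mpr (hroot y hy hWy))
  have hw0 := cotPoly_ne_zero c d n
  have hg0 : g ≠ 0 := by
    rintro rfl
    exact hw0 (by rw [hg, mul_zero])
  have hdeg : 2 + g.natDegree ≤ n := by
    have h := natDegree_cotPoly_le c d n
    rwa [hg, Polynomial.natDegree_mul (mul_ne_zero (Polynomial.X_sub_C_ne_zero _)
      (Polynomial.X_sub_C_ne_zero _)) hg0, Polynomial.natDegree_mul (Polynomial.X_sub_C_ne_zero _)
      (Polynomial.X_sub_C_ne_zero _), Polynomial.natDegree_X_sub_C,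
      Polynomial.natDegree_X_sub_C] at h
  obtain ⟨m, rfl⟩ : ∃ m, n = m + 2 := ⟨n - 2, by omega⟩
  obtain ⟨F, hFmem, hFcont, hFzero, hFeq⟩ :=
    exists_memOmega_eq_pow_mul_eval (g := g) (m := m) (by omega)
  have hprod : ∀ z ∈ Set.Ioo (-1 : ℝ) 1, F z * W c d (m + 2) z =
      √(1 - z ^ 2) ^ (2 * m + 3) * (g.eval (τ z) ^ 2 * ((τ z - τ x) * (τ z - τ y))) := by
    intro z hz
    rw [hFeq z hz, W_eq_pow_mul_eval_cotPoly c d hz, hg]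
    simp only [Polynomial.eval_mul, Polynomial.eval_sub, Polynomial.eval_X, Polynomial.eval_C, hτ]
    ring
  have hend : ∀ z ∈ Set.Icc (-1 : ℝ) 1, z ∉ Set.Ioo (-1 : ℝ) 1 → z = -1 ∨ z = 1 := by
    intro z hz hz'
    by_contra! h
    exact hz' ⟨lt_of_le_of_ne hz.1 h.1.symm, lt_of_le_of_ne hz.2 h.2⟩
  have hnonneg : ∀ z ∈ Set.Icc (-1 : ℝ) 1, z ∉ Set.Ioo β₂ β₁ → 0 ≤ F z * W c d (m + 2) z := by
    intro z hz hgap'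
    by_cases hz' : z ∈ Set.Ioo (-1 : ℝ) 1
    · rw [hprod z hz']
      refine mul_nonneg (by positivity) (mul_nonneg (sq_nonneg _) ?_)
      rcases le_or_gt z β₂ with h | h
      · exact mul_nonneg_of_nonpos_of_nonpos
          (sub_nonpos.mpr (hmono.monotoneOn hz' (hsub x hx) (h.trans hx.1)))
          (sub_nonpos.mpr (hmono.monotoneOn hz' (hsub y hy) (h.trans hy.1)))
      · have h' : β₁ ≤ z := not_lt.mp fun h' => hgap' ⟨h, h'⟩
        exact mul_nonneg
          (sub_nonneg.mpr (hmono.monotoneOn (hsub x hx) hz' (hx.2.trans h')))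
          (sub_nonneg.mpr (hmono.monotoneOn (hsub y hy) hz' (hy.2.trans h')))
    · rw [hFzero z (by rcases hend z hz hz' with rfl | rfl <;> simp), zero_mul]
  have hgap0 : ψ (Set.Ioo β₂ β₁) = 0 := measure_eq_zero_of_disjoint_msupport hgap
  have hIcc : ∀ᵐ z ∂ψ, z ∈ Set.Icc (-1 : ℝ) 1 := hnull
  have hae : ∀ᵐ z ∂ψ, z ∉ Set.Ioo β₂ β₁ := measure_eq_zero_iff_ae_notMem.mp hgap0
  have hres : ψ.restrict (Set.Icc (-1 : ℝ) 1) = ψ := Measure.restrict_eq_self_of_ae_mem hIcc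
  have hcont : Continuous fun z => F z * W c d (m + 2) z := hFcont.mul (continuous_W c d _)
  have hint : Integrable (fun z => F z * W c d (m + 2) z) ψ := by
    rw [← hres]
    exact hcont.integrableOn_Icc
  have hzero := horth (m + 2) (by omega) F hFmem
  rw [hres, integral_eq_zero_iff_of_nonneg_ae
    (by filter_upwards [hIcc, hae] with z h₁ h₂ using hnonneg z h₁ h₂) hint] at hzero
  have hfin : ({-1, 1} ∪ {z ∈ Set.Ioo (-1 : ℝ) 1 |
      (g * cotPoly c d (m + 2)).eval (z / √(1 - z ^ 2)) = 0}).Finite :=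
    (Set.toFinite _).union (finite_setOf_eval_div_sqrt_eq_zero (mul_ne_zero hg0 hw0))
  refine hinf (hfin.subset (msupport_subset_of_isClosed hfin.isClosed ?_))
  refine mem_ae_iff.mp ?_
  filter_upwards [hIcc, hzero] with z hz hz0
  by_cases hz' : z ∈ Set.Ioo (-1 : ℝ) 1
  · refine Or.inr ⟨hz', ?_⟩
    have hs := (sqrt_one_sub_sq_pos hz').ne'
    rw [Pi.zero_apply, hFeq z hz', W_eq_pow_mul_eval_cotPoly c d hz'] at hz0
    rw [Polynomial.eval_mul]
    rcases mul_eq_zero.mp hz0 with h | h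
    · rw [(mul_eq_zero.mp h).resolve_left (pow_ne_zero _ hs), zero_mul]
    · rw [(mul_eq_zero.mp h).resolve_left (pow_ne_zero _ hs), mul_zero]
  · exact Or.inl (hend z hz hz')
end
end
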